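/- Let Θ ⊆ ℝ^q, let Σ : Θ → (p×p real positive definite matrices) be a map, and let θ₀ ∈ Θ satisfy the identifiability condition: for all θ ∈ Θ, Σ(θ) = Σ(θ₀) implies θ = θ₀. Define H(θ) = −(1/2) log det Σ(θ) − (1/2) tr(Σ(θ)⁻¹ Σ(θ₀)). Then H(θ) ≤ H(θ₀) for every θ ∈ Θ, with equality if and only if θ = θ₀; that is, θ₀ is the unique maximizer of H over Θ. -/

import Mathlib

open Matrix

theorem Matrix.IsHermitian.trace_sub_card_eq_sum {n : Type*} [Fintype n] [DecidableEq n]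
    {M : Matrix n n ℝ} (hM : M.IsHermitian) :
    M.trace - Fintype.card n = ∑ i, (hM.eigenvalues i - 1) := by
  rw [hM.trace_eq_sum_eigenvalues]
  simp

namespace Matrix.PosDef

variable {n : Type*} [Fintype n] [DecidableEq n] {A B M : Matrix n n ℝ}

theorem log_det_eq_sum_log_eigenvalues (hM : M.PosDef) :
    Real.log M.det = ∑ i, Real.log (hM.1.eigenvalues i) := by
  rw [hM.1.det_eq_prod_eigenvalues]
  exact Real.log_prod fun i _ => (hM.eigenvalues_pos i).ne'

theorem log_det_le_trace_sub_card (hM : M.PosDef) :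
    Real.log M.det ≤ M.trace - Fintype.card n := by
  rw [hM.log_det_eq_sum_log_eigenvalues, hM.1.trace_sub_card_eq_sum]
  exact Finset.sum_le_sum fun i _ => Real.log_le_sub_one_of_pos (hM.eigenvalues_pos i)

theorem eq_one_of_log_det_eq (hM : M.PosDef)
    (h : Real.log M.det = M.trace - Fintype.card n) : M = 1 := by
  rw [hM.log_det_eq_sum_log_eigenvalues, hM.1.trace_sub_card_eq_sum, Finset.sum_eq_sum_iff_of_le
    fun i _ => Real.log_le_sub_one_of_pos (hM.eigenvalues_pos i)] at h
  have heig : hM.1.eigenvalues = 1 := by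
    ext i
    by_contra hne
    exact (Real.log_lt_sub_one_of_pos (hM.eigenvalues_pos i) hne).ne (h i (Finset.mem_univ i))
  rw [hM.1.spectral_theorem, heig]
  have hdiag : diagonal (RCLike.ofReal ∘ (1 : n → ℝ)) = (1 : Matrix n n ℝ) := by
    ext i j
    simp [diagonal_apply, one_apply]
  rw [hdiag, map_one]

/-- The congruence of `B` by a square root of `A⁻¹` has the trace and determinant
of `A⁻¹ * B`. -/
theorem exists_posDef_trace_eq_det_eq (hA : A.PosDef) (hB : B.PosDef) :
    ∃ M : Matrix n n ℝ, M.PosDef ∧ M.trace = (A⁻¹ * B).trace ∧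
      M.det = (A⁻¹ * B).det ∧ (M = 1 → A = B) := by
  obtain ⟨R, hR, hAR⟩ : ∃ R : Matrix n n ℝ, IsUnit R ∧ A⁻¹ = Rᴴ * R := by
    open scoped MatrixOrder in
    exact CStarAlgebra.isStrictlyPositive_iff_eq_star_mul_self.1 hA.inv.isStrictlyPositive
  have hdet : IsUnit R.det := (isUnit_iff_isUnit_det R).1 hR
  refine ⟨R * B * Rᴴ, hB.mul_mul_conjTranspose_same (vecMul_injective_of_isUnit hR),
    ?_, ?_, fun h => ?_⟩
  · rw [hAR, trace_mul_comm, ← mul_assoc]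
  · rw [hAR]
    simp only [det_mul]
    ring
  · have hAB : A⁻¹ * B = 1 := by
      have h' : R * (B * Rᴴ) = 1 := by rw [← mul_assoc, h]
      have h'' : B * Rᴴ * R = 1 := mul_eq_one_comm.1 h'
      rw [hAR, ← mul_eq_one_comm, ← mul_assoc, h'']
    rw [← inv_eq_right_inv hAB,
      nonsing_inv_nonsing_inv _ ((isUnit_iff_isUnit_det A).1 hA.isUnit)]

end Matrix.PosDef

/-- If `Σ : Θ → (p × p positive definite matrices)` is identifiable at `θ₀ ∈ Θ`, then
`H(θ) = -(1/2) log det Σ(θ) - (1/2) tr(Σ(θ)⁻¹ Σ(θ₀))` has `θ₀` as its unique maximizer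
over `Θ`. -/
theorem stmt_3 (p q : ℕ) (Θ : Set (Fin q → ℝ))
    (Sg : (Fin q → ℝ) → Matrix (Fin p) (Fin p) ℝ)
    (hpos : ∀ θ ∈ Θ, (Sg θ).PosDef)
    (θ₀ : Fin q → ℝ) (hθ₀ : θ₀ ∈ Θ)
    (hident : ∀ θ ∈ Θ, Sg θ = Sg θ₀ → θ = θ₀)
    (H : (Fin q → ℝ) → ℝ)
    (hH : ∀ θ, H θ = -(1 / 2) * Real.log (Sg θ).det - (1 / 2) * ((Sg θ)⁻¹ * Sg θ₀).trace) :
    ∀ θ ∈ Θ, H θ ≤ H θ₀ ∧ (H θ = H θ₀ ↔ θ = θ₀) := by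
  intro θ hθ
  have hA := hpos θ hθ
  have hB := hpos θ₀ hθ₀
  obtain ⟨M, hM, htr, hdet, hone⟩ := hA.exists_posDef_trace_eq_det_eq hB
  have hlog : Real.log M.det = Real.log (Sg θ₀).det - Real.log (Sg θ).det := by
    rw [hdet, det_mul, det_nonsing_inv, Ring.inverse_eq_inv',
      Real.log_mul (inv_ne_zero hA.det_pos.ne') hB.det_pos.ne', Real.log_inv]
    ring
  have hself : ((Sg θ₀)⁻¹ * Sg θ₀).trace = Fintype.card (Fin p) := by
    rw [nonsing_inv_mul _ ((isUnit_iff_isUnit_det _).1 hB.isUnit), trace_one]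
  have hle := hM.log_det_le_trace_sub_card
  have hH₁ := hH θ
  have hH₀ := hH θ₀
  rw [← htr] at hH₁
  rw [hself] at hH₀
  refine ⟨by linarith, fun heq => ?_, fun h => by rw [h]⟩
  exact hident θ hθ (hone (hM.eq_one_of_log_det_eq (by linarith)))
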